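/- In Ỹ (with higher modes defined by the recursion in the context), for every i ∈ I with i ∉ {0,m} and all r,s ∈ ℤ_{≥0}: (1) [h_{i,r}, h_{i,s}] = 0; (2) [x⁺_{i,r}, x⁻_{i,s}] = h_{i,r+s}; (3) [x^±_{i,r+1}, x^±_{i,s}] − [x^±_{i,r}, x^±_{i,s+1}] = ±a_{i,i}((ε₁+ε₂)/2){x^±_{i,r}, x^±_{i,s}} − b_{i,i}((ε₁−ε₂)/2)[x^±_{i,r}, x^±_{i,s}]; (4) [h_{i,r+1}, x^±_{i,s}] − [h_{i,r}, x^±_{i,s+1}] = ±a_{i,i}((ε₁+ε₂)/2){h_{i,r}, x^±_{i,s}} − b_{i,i}((ε₁−ε₂)/2)[h_{i,r}, x^±_{i,s}]. -/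

import Mathlib

noncomputable section

open scoped BigOperators

/-- The parity function `p` on indices, realized on `ZMod (m+n)`:
`p(i) = 0` for `1 ≤ i ≤ m` and `p(i) = 1` otherwise (so `p(0) = 1`). -/
def ppar (m n : ℕ) (i : ZMod (m + n)) : ℕ :=
  if 1 ≤ i.val ∧ i.val ≤ m then 0 else 1

/-- Parity of the generators `x^±_{i,r}`: they are odd exactly when `i = 0` or `i = m`. -/
def gpar (m n : ℕ) (i : ZMod (m + n)) : ℕ := (ppar m n i + ppar m n (i + 1)) % 2

/-- The integer valued Cartan matrix `a_{i,j}` of `\hat{sl}(m|n)`.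
The cyclic cases `(0, m+n-1)` and `(m+n-1, 0)` are covered by the clauses
`j = i - 1` and `j = i + 1` in `ZMod (m+n)`. -/
def aZ (m n : ℕ) (i j : ZMod (m + n)) : ℤ :=
  if i = j then (-1) ^ ppar m n i + (-1) ^ ppar m n (i + 1)
  else if j = i + 1 then -(-1) ^ ppar m n (i + 1)
  else if j = i - 1 then -(-1) ^ ppar m n i
  else 0

/-- `a_{i,j}` as a complex number. -/
def aC (m n : ℕ) (i j : ZMod (m + n)) : ℂ := (aZ m n i j : ℂ)

/-- The matrix `b_{i,j}`. -/
def bC (m n : ℕ) (i j : ZMod (m + n)) : ℂ :=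
  if i = ((m + n - 1 : ℕ) : ZMod (m + n)) ∧ j = 0 then 1
  else if i = j + 1 then -(-1) ^ ppar m n (i + 1)
  else if i = j - 1 then (-1) ^ ppar m n i
  else 0

variable {A : Type*} [Ring A] [Algebra ℂ A]

/-- The supercommutator `[x,y] = xy - (-1)^{p(x)p(y)} yx` of elements of parities `px`, `py`. -/
def sbr (px py : ℕ) (x y : A) : A := x * y - ((-1 : ℂ) ^ (px * py)) • (y * x)

/-- The anticommutator `{x,y} = xy + yx`. -/
def acm (x y : A) : A := x * y + y * x

/-- The sign `±1` governing the `x^+`/`x^-` cases. -/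
def sgn (b : Bool) : ℂ := if b then 1 else -1

/-- Iterated super-adjoint action `(ad x)^k y`, where `x` has parity `px` and `y` parity `py`. -/
def adPow (px : ℕ) (x : A) (py : ℕ) (y : A) : ℕ → A
  | 0 => y
  | k + 1 => sbr px ((py + k * px) % 2) x (adPow px x py y k)

/-- Nested supercommutator `[g 0, [g 1, … , [g (k-1), y] … ]]` where every `g l`
has parity `px` and `y` has parity `py`. -/
def serreNest (px py : ℕ) : (k : ℕ) → (Fin k → A) → A → A
  | 0, _, y => y
  | k + 1, g, y => sbr px ((py + k * px) % 2) (g 0) (serreNest px py k (fun l => g l.succ) y)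

/-- `h̃_{i,1} = h_{i,1} - ((ε₁+ε₂)/2) h_{i,0}²`. -/
def htld (m n : ℕ) (ε₁ ε₂ : ℂ) (H : ZMod (m + n) → ℕ → A) (i : ZMod (m + n)) : A :=
  H i 1 - ((ε₁ + ε₂) / 2) • (H i 0 * H i 0)

/-- A representation of the minimalistic presentation `Ỹ` of the affine super Yangian
`Y_{ε₁,ε₂}(ŝl(m|n))`: elements `x^±_{i,r}`, `h_{i,r}` of an associative `ℂ`-algebra
satisfying the defining relations (2.1)–(2.9) for the modes `r ∈ {0,1}`, together with
the recursive definition of the higher modes `r ≥ 2`. -/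
structure YtildeRep (m n : ℕ) (ε₁ ε₂ : ℂ) (A : Type*) [Ring A] [Algebra ℂ A] where
  /-- `x^+_{i,r}` (`b = true`) and `x^-_{i,r}` (`b = false`). -/
  X : Bool → ZMod (m + n) → ℕ → A
  /-- `h_{i,r}`. -/
  H : ZMod (m + n) → ℕ → A
  rel21 : ∀ (i j : ZMod (m + n)) (r s : ℕ), r ≤ 1 → s ≤ 1 → H i r * H j s = H j s * H i r
  rel22 : ∀ i j : ZMod (m + n),
      sbr (gpar m n i) (gpar m n j) (X true i 0) (X false j 0) = if i = j then H i 0 else 0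
  rel23a : ∀ i j : ZMod (m + n),
      sbr (gpar m n i) (gpar m n j) (X true i 1) (X false j 0) = if i = j then H i 1 else 0
  rel23b : ∀ i j : ZMod (m + n),
      sbr (gpar m n i) (gpar m n j) (X true i 0) (X false j 1) = if i = j then H i 1 else 0
  rel24 : ∀ (b : Bool) (i j : ZMod (m + n)) (r : ℕ), r ≤ 1 →
      H i 0 * X b j r - X b j r * H i 0 = (sgn b * aC m n i j) • X b j r
  rel25 : ∀ (b : Bool) (i j : ZMod (m + n)),
      htld m n ε₁ ε₂ H i * X b j 0 - X b j 0 * htld m n ε₁ ε₂ H i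
        = (sgn b * aC m n i j) • (X b j 1 - (bC m n i j * ((ε₁ - ε₂) / 2)) • X b j 0)
  rel26 : ∀ (b : Bool) (i j : ZMod (m + n)),
      sbr (gpar m n i) (gpar m n j) (X b i 1) (X b j 0)
          - sbr (gpar m n i) (gpar m n j) (X b i 0) (X b j 1)
        = (sgn b * aC m n i j * ((ε₁ + ε₂) / 2)) • acm (X b i 0) (X b j 0)
          - (bC m n i j * ((ε₁ - ε₂) / 2)) •
              sbr (gpar m n i) (gpar m n j) (X b i 0) (X b j 0)
  rel27 : ∀ (b : Bool) (i j : ZMod (m + n)), i ≠ j →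
      adPow (gpar m n i) (X b i 0) (gpar m n j) (X b j 0) (1 + (aZ m n i j).natAbs) = 0
  rel28 : ∀ (b : Bool) (i : ZMod (m + n)), i = 0 ∨ i = (m : ZMod (m + n)) →
      sbr (gpar m n i) (gpar m n i) (X b i 0) (X b i 0) = 0
  rel29 : ∀ (b : Bool) (i : ZMod (m + n)), i = 0 ∨ i = (m : ZMod (m + n)) →
      sbr ((gpar m n (i - 1) + gpar m n i) % 2) ((gpar m n i + gpar m n (i + 1)) % 2)
        (sbr (gpar m n (i - 1)) (gpar m n i) (X b (i - 1) 0) (X b i 0))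
        (sbr (gpar m n i) (gpar m n (i + 1)) (X b i 0) (X b (i + 1) 0)) = 0
  recX : ∀ (b : Bool) (i : ZMod (m + n)) (r : ℕ), 1 ≤ r →
      X b i (r + 1) =
        if i = 0 ∨ i = (m : ZMod (m + n)) then
          (sgn b * (aC m n (i + 1) i)⁻¹) •
              (htld m n ε₁ ε₂ H (i + 1) * X b i r - X b i r * htld m n ε₁ ε₂ H (i + 1))
            + (bC m n (i + 1) i * ((ε₁ - ε₂) / 2)) • X b i r
        else
          (sgn b * (aC m n i i)⁻¹) •
            (htld m n ε₁ ε₂ H i * X b i r - X b i r * htld m n ε₁ ε₂ H i)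
  recH : ∀ (i : ZMod (m + n)) (r : ℕ), 1 ≤ r →
      H i (r + 1) = sbr (gpar m n i) (gpar m n i) (X true i (r + 1)) (X false i 0)



/-- The bracket `xy - η yx`, twisted by a scalar `η`. -/
def tbr (η : ℂ) (x y : A) : A := x * y - η • (y * x)

theorem ring_lie_mul {R : Type*} [Ring R] (d x y : R) : ⁅d, x * y⁆ = ⁅d, x⁆ * y + x * ⁅d, y⁆ := by
  simp only [Ring.lie_def]; noncomm_ring

theorem ring_mul_lie {R : Type*} [Ring R] (x y d : R) : ⁅x * y, d⁆ = ⁅x, d⁆ * y + x * ⁅y, d⁆ := by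
  simp only [Ring.lie_def]; noncomm_ring

theorem ring_lie_add {R : Type*} [Ring R] (d x y : R) : ⁅d, x + y⁆ = ⁅d, x⁆ + ⁅d, y⁆ := by
  simp only [Ring.lie_def]; noncomm_ring

theorem ring_lie_sub {R : Type*} [Ring R] (d x y : R) : ⁅d, x - y⁆ = ⁅d, x⁆ - ⁅d, y⁆ := by
  simp only [Ring.lie_def]; noncomm_ring

theorem ring_lie_neg {R : Type*} [Ring R] (d x : R) : ⁅d, -x⁆ = -⁅d, x⁆ := by
  simp only [Ring.lie_def]; noncomm_ring

theorem ring_neg_lie {R : Type*} [Ring R] (d x : R) : ⁅-d, x⁆ = -⁅d, x⁆ := by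
  simp only [Ring.lie_def]; noncomm_ring

theorem ring_add_lie {R : Type*} [Ring R] (d x y : R) : ⁅d + x, y⁆ = ⁅d, y⁆ + ⁅x, y⁆ := by
  simp only [Ring.lie_def]; noncomm_ring

theorem ring_sub_lie {R : Type*} [Ring R] (d x y : R) : ⁅d - x, y⁆ = ⁅d, y⁆ - ⁅x, y⁆ := by
  simp only [Ring.lie_def]; noncomm_ring

theorem ring_lie_zero {R : Type*} [Ring R] (d : R) : ⁅d, (0 : R)⁆ = 0 := by
  simp [Ring.lie_def]

theorem ring_zero_lie {R : Type*} [Ring R] (d : R) : ⁅(0 : R), d⁆ = 0 := by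
  simp [Ring.lie_def]

theorem ring_lie_skew {R : Type*} [Ring R] (d x : R) : ⁅d, x⁆ = -⁅x, d⁆ := by
  simp only [Ring.lie_def]; noncomm_ring

theorem ring_lie_lie {R : Type*} [Ring R] (d x y : R) : ⁅d, ⁅x, y⁆⁆ = ⁅⁅d, x⁆, y⁆ + ⁅x, ⁅d, y⁆⁆ := by
  simp only [Ring.lie_def]; noncomm_ring

theorem ring_lie_smul (k : ℂ) (d x : A) : ⁅d, k • x⁆ = k • ⁅d, x⁆ := by
  simp only [Ring.lie_def, mul_smul_comm, smul_mul_assoc, smul_sub]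

theorem ring_smul_lie (k : ℂ) (d x : A) : ⁅k • d, x⁆ = k • ⁅d, x⁆ := by
  simp only [Ring.lie_def, mul_smul_comm, smul_mul_assoc, smul_sub]

theorem lie_tbr (η : ℂ) (d x y : A) : ⁅d, tbr η x y⁆ = tbr η ⁅d, x⁆ y + tbr η x ⁅d, y⁆ := by
  simp only [tbr, ring_lie_sub, ring_lie_smul, ring_lie_mul, smul_add]; module

theorem lie_tbr_lie_succ (η c b α : ℂ) (d X X' Y Y' H H' G G' : A)
    (dX : ⁅d, X⁆ = X') (dY : ⁅d, Y⁆ = -Y') (dH : ⁅d, H⁆ = 0)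
    (Sx : ⁅H', X⁆ = ⁅H, X'⁆ + c • (H * X + X * H) - b • ⁅H, X⁆)
    (Sy : ⁅H', Y⁆ = ⁅H, Y'⁆ - c • (H * Y + Y * H) - b • ⁅H, Y⁆)
    (e1 : ⁅d, tbr η X ⁅H, Y'⁆⁆ = c • ⁅H, X * Y' + η • (Y' * X)⁆ - α • G)
    (e2 : ⁅d, tbr η X ⁅H, Y⁆⁆ = c • ⁅H, X * Y + η • (Y * X)⁆)
    (hv1 : tbr η X' Y = G') (hv2 : tbr η X Y' = G') (hz : ⁅H, tbr η X Y⁆ = 0) :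
    ⁅d, tbr η X ⁅H', Y⁆⁆ = c • ⁅H', X * Y + η • (Y * X)⁆ - α • G := by
  have e3 : ⁅d, tbr η X (H * Y + Y * H)⁆ = tbr η X' (H * Y + Y * H) - tbr η X (H * Y' + Y' * H) := by
    rw [lie_tbr, dX, ring_lie_add, ring_lie_mul, ring_lie_mul, dH, dY]
    simp only [tbr, mul_neg, neg_mul, zero_mul, mul_zero, mul_add, add_mul, smul_add, smul_neg]
    module
  have e4 : ⁅d, tbr η X ⁅H', Y⁆⁆ = ⁅d, tbr η X ⁅H, Y'⁆⁆ - c • ⁅d, tbr η X (H * Y + Y * H)⁆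
      - b • ⁅d, tbr η X ⁅H, Y⁆⁆ := by
    have : tbr η X ⁅H', Y⁆ = tbr η X ⁅H, Y'⁆ - c • tbr η X (H * Y + Y * H)
        - b • tbr η X ⁅H, Y⁆ := by
      rw [Sy]
      simp only [tbr, mul_sub, sub_mul, mul_smul_comm, smul_mul_assoc, smul_sub]
      module
    rw [this, ring_lie_sub, ring_lie_sub, ring_lie_smul, ring_lie_smul]
  rw [e4, e1, e2, e3]
  simp only [ring_lie_add, ring_lie_smul, ring_lie_mul, Sx, Sy]
  subst hv2
  simp only [tbr, Ring.lie_def] at *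
  linear_combination (norm := skip) (-c) • congrArg (fun z => H * z + z * H) hv1 - (c * c) • hz
  simp only [mul_add, add_mul, mul_sub, sub_mul, mul_smul_comm, smul_mul_assoc,
    mul_assoc, smul_add, smul_sub, smul_smul]
  module

theorem lie_lie_tbr_succ (η c b α : ℂ) (d X X' Y Y' H H' G G' : A)
    (dX : ⁅d, X⁆ = X') (dY : ⁅d, Y⁆ = -Y') (dH : ⁅d, H⁆ = 0)
    (Sx : ⁅H', X⁆ = ⁅H, X'⁆ + c • (H * X + X * H) - b • ⁅H, X⁆)
    (Sy : ⁅H', Y⁆ = ⁅H, Y'⁆ - c • (H * Y + Y * H) - b • ⁅H, Y⁆)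
    (e : ⁅d, tbr η X ⁅H, Y⁆⁆ = c • ⁅H, X * Y + η • (Y * X)⁆ - α • G)
    (hE : ⁅H, tbr η X' Y⁆ = G') (hz : ⁅H, tbr η X Y⁆ = 0) :
    ⁅H', tbr η X Y⁆ = G' + α • G := by
  have e3 : ⁅d, tbr η X ⁅H, Y⁆⁆ = tbr η X' ⁅H, Y⁆ - tbr η X ⁅H, Y'⁆ := by
    rw [lie_tbr, dX, ring_lie_lie, dH, dY, ring_lie_neg]
    simp only [tbr, Ring.lie_def, mul_neg, neg_mul, zero_mul, mul_zero, sub_zero, zero_add, smul_neg]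
    module
  rw [e3] at e
  have e5 : α • G = c • ⁅H, X * Y + η • (Y * X)⁆ - (tbr η X' ⁅H, Y⁆ - tbr η X ⁅H, Y'⁆) := by
    rw [e]; module
  rw [lie_tbr, Sx, Sy, e5, ← hE]
  linear_combination (norm := skip) (-b) • hz
  simp only [tbr, Ring.lie_def, mul_add, add_mul, mul_sub, sub_mul, mul_smul_comm, smul_mul_assoc,
    mul_assoc, smul_add, smul_sub, smul_smul]
  module

/-- If the brackets `[x_p, y_q]` depend only on `p + q ≤ N`, the brackets of the next degree are
acted on by the Cartan modes through a common element. -/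
theorem lie_tbr_eq (η c b α : ℂ) (d : A) (x y h g : ℕ → A) (J N : ℕ)
    (hx : ∀ s, ⁅h 0, x s⁆ = α • x s) (hy : ∀ s, ⁅h 0, y s⁆ = -(α • y s))
    (dx : ∀ s, ⁅d, x s⁆ = x (s + 1)) (dy : ∀ s, ⁅d, y s⁆ = -y (s + 1))
    (dh : ∀ j < J, ⁅d, h j⁆ = 0)
    (Sx : ∀ r < J, ∀ s,
      ⁅h (r + 1), x s⁆ = ⁅h r, x (s + 1)⁆ + c • (h r * x s + x s * h r) - b • ⁅h r, x s⁆)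
    (Sy : ∀ r < J, ∀ s,
      ⁅h (r + 1), y s⁆ = ⁅h r, y (s + 1)⁆ - c • (h r * y s + y s * h r) - b • ⁅h r, y s⁆)
    (hV : ∀ p q, p + q ≤ N → tbr η (x p) (y q) = g (p + q))
    (dg : ∀ k < N, ⁅d, g k⁆ = 0)
    (hg : ∀ j < J, ∀ k, j + k ≤ N → ⁅h j, g k⁆ = 0) (j : ℕ) (hj : j ≤ J) (p q : ℕ)
    (hpq : j + p + q = N + 1) :
    ⁅h j, tbr η (x p) (y q)⁆ = ((j : ℂ) * α) • ⁅d, g N⁆ := by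
  have weight : ∀ p q, ⁅h 0, tbr η (x p) (y q)⁆ = 0 := by
    intro p q
    rw [lie_tbr, hx, hy]
    simp only [tbr, smul_mul_assoc, mul_smul_comm, mul_neg, neg_mul]
    module
  have shifted : ∀ j < J, ∀ p q, j + p + q ≤ N → ⁅d, tbr η (x p) ⁅h j, y q⁆⁆
      = c • ⁅h j, x p * y q + η • (y q * x p)⁆ - α • ⁅d, g (j + p + q)⁆ := by
    intro j
    induction j with
    | zero =>
      intro _ p q hpq
      have h1 : ⁅h 0, x p * y q + η • (y q * x p)⁆ = 0 := by
        simp only [ring_lie_add, ring_lie_smul, ring_lie_mul, hx, hy, smul_mul_assoc,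
          mul_smul_comm, mul_neg, neg_mul]
        module
      have h2 : tbr η (x p) ⁅h 0, y q⁆ = -(α • tbr η (x p) (y q)) := by
        rw [hy]
        simp only [tbr, smul_mul_assoc, mul_smul_comm, mul_neg, neg_mul]
        module
      rw [h1, h2, hV p q (by omega), ring_lie_neg, ring_lie_smul, zero_add]
      module
    | succ j ih =>
      intro hj p q hpq
      have e1 := ih (by omega) p (q + 1) (by omega)
      have e2 := ih (by omega) p q (by omega)
      rw [dg _ (by omega), smul_zero, sub_zero] at e2
      have := lie_tbr_lie_succ η c b α d (x p) (x (p + 1)) (y q) (y (q + 1)) (h j) (h (j + 1))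
        ⁅d, g (j + p + (q + 1))⁆ (g (p + q + 1)) (dx p) (dy q) (dh j (by omega))
        (Sx j (by omega) p) (Sy j (by omega) q) e1 e2
        (by rw [hV _ _ (by omega)]; congr 1; omega) (by rw [hV _ _ (by omega)]; congr 1)
        (by rw [hV p q (by omega)]; exact hg j (by omega) _ (by omega))
      rw [this, show j + p + (q + 1) = j + 1 + p + q by omega]
  induction j generalizing p q with
  | zero => rw [weight]; simp
  | succ j ih =>
    have e := shifted j (by omega) p q (by omega)
    have hN : j + p + q = N := by omega
    rw [hN] at e
    have := lie_lie_tbr_succ η c b α d (x p) (x (p + 1)) (y q) (y (q + 1)) (h j) (h (j + 1)) _ _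
      (dx p) (dy q) (dh j (by omega)) (Sx j (by omega) p) (Sy j (by omega) q) e
      (ih (by omega) (p + 1) q (by omega))
      (by rw [hV p q (by omega)]; exact hg j (by omega) _ (by omega))
    rw [this]
    push_cast
    module

theorem tbr_lie_left (θ : ℂ) (X Y Z : A) (h : ⁅Z, Y⁆ = 0) :
    tbr θ ⁅X, Z⁆ Y = ⁅tbr θ X Y, Z⁆ := by
  rw [Ring.lie_def, sub_eq_zero] at h
  simp only [tbr, Ring.lie_def, mul_sub, sub_mul, smul_sub, mul_smul_comm, smul_mul_assoc,
    mul_assoc, h]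
  simp only [← mul_assoc, h]
  module

theorem tbr_lie_right (θ : ℂ) (X Y W : A) (h : ⁅X, W⁆ = 0) :
    tbr θ X ⁅Y, W⁆ = ⁅tbr θ X Y, W⁆ := by
  rw [Ring.lie_def, sub_eq_zero] at h
  simp only [tbr, Ring.lie_def, mul_sub, sub_mul, smul_sub, mul_smul_comm, smul_mul_assoc,
    mul_assoc, h]
  simp only [← mul_assoc, h]
  module

theorem tbr_acm_left (θ : ℂ) (X Y Z : A) (h : ⁅Z, Y⁆ = 0) :
    tbr θ (X * Z + Z * X) Y = tbr θ X Y * Z + Z * tbr θ X Y := by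
  rw [Ring.lie_def, sub_eq_zero] at h
  simp only [tbr, mul_add, add_mul, mul_sub, sub_mul, smul_add, mul_smul_comm, smul_mul_assoc,
    mul_assoc, h]
  simp only [← mul_assoc, h]
  module

theorem tbr_acm_right (θ : ℂ) (X Y W : A) (h : ⁅X, W⁆ = 0) :
    tbr θ X (Y * W + W * Y) = tbr θ X Y * W + W * tbr θ X Y := by
  rw [Ring.lie_def, sub_eq_zero] at h
  simp only [tbr, mul_add, add_mul, mul_sub, sub_mul, smul_add, mul_smul_comm, smul_mul_assoc,
    mul_assoc, h]
  simp only [← mul_assoc, h]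
  module

theorem lie_of_exchange_left (θ c b : ℂ) (X X' Y Z Z' H H' : A) (h : ⁅Z, Y⁆ = 0) (h' : ⁅Z', Y⁆ = 0)
    (R : ⁅X', Z⁆ - ⁅X, Z'⁆ = c • (X * Z + Z * X) - b • ⁅X, Z⁆)
    (hH : tbr θ X Y = H) (hH' : tbr θ X' Y = H') :
    ⁅H', Z⁆ = ⁅H, Z'⁆ + c • (H * Z + Z * H) - b • ⁅H, Z⁆ := by
  have R' : ⁅X', Z⁆ = ⁅X, Z'⁆ + c • (X * Z + Z * X) - b • ⁅X, Z⁆ := by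
    linear_combination (norm := module) R
  rw [← hH', ← tbr_lie_left _ _ _ _ h, R', ← hH, ← tbr_lie_left _ _ _ _ h,
    ← tbr_lie_left _ _ _ _ h', ← tbr_acm_left _ _ _ _ h]
  simp only [tbr, mul_add, add_mul, mul_sub, sub_mul, smul_add, mul_smul_comm, smul_mul_assoc]
  module

theorem lie_of_exchange_right (θ c b : ℂ) (X Y Y' W W' H H' : A) (h : ⁅X, W⁆ = 0)
    (h' : ⁅X, W'⁆ = 0)
    (R : ⁅Y', W⁆ - ⁅Y, W'⁆ = -(c • (Y * W + W * Y)) - b • ⁅Y, W⁆)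
    (hH : tbr θ X Y = H) (hH' : tbr θ X Y' = H') :
    ⁅H', W⁆ = ⁅H, W'⁆ - c • (H * W + W * H) - b • ⁅H, W⁆ := by
  have R' : ⁅Y', W⁆ = ⁅Y, W'⁆ - c • (Y * W + W * Y) - b • ⁅Y, W⁆ := by
    linear_combination (norm := module) R
  rw [← hH', ← tbr_lie_right _ _ _ _ h, R', ← hH, ← tbr_lie_right _ _ _ _ h,
    ← tbr_lie_right _ _ _ _ h', ← tbr_acm_right _ _ _ _ h]
  simp only [tbr, mul_add, add_mul, mul_sub, sub_mul, smul_add, mul_smul_comm, smul_mul_assoc]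
  module

/-- An exchange relation propagates along a derivation killing the Cartan elements. -/
theorem exchange_propagate (c b : ℂ) (d H H' : A) (z : ℕ → A) (dz : ∀ s, ⁅d, z s⁆ = z (s + 1))
    (dH : ⁅d, H⁆ = 0) (dH' : ⁅d, H'⁆ = 0)
    (h : ⁅H', z 0⁆ = ⁅H, z 1⁆ + c • (H * z 0 + z 0 * H) - b • ⁅H, z 0⁆) (s : ℕ) :
    ⁅H', z s⁆ = ⁅H, z (s + 1)⁆ + c • (H * z s + z s * H) - b • ⁅H, z s⁆ := by
  induction s with
  | zero => exact h
  | succ s ih =>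
    have := congrArg (fun v => ⁅d, v⁆) ih
    simpa only [ring_lie_lie, ring_lie_add, ring_lie_sub, ring_lie_smul, ring_lie_mul, dH, dH', dz,
      ring_zero_lie, ring_lie_zero, zero_mul, mul_zero, sub_zero, zero_add, add_zero] using this

theorem iterate_lie_eq_zero {R : Type*} [Ring R] (d e v : R) (hde : ⁅d, e⁆ = 0) (h : ⁅e, v⁆ = 0)
    (s : ℕ) :
    ⁅e, (fun u => ⁅d, u⁆)^[s] v⁆ = 0 := by
  induction s with
  | zero => exact h
  | succ s ih =>
    rw [Function.iterate_succ_apply', ring_lie_lie, ih, ring_lie_skew e d, hde]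
    simp [Ring.lie_def]

/-- The action of the Cartan elements attached to one node on those attached to an adjacent node. -/
theorem cartan_lie_cartan (θ η c b α : ℂ) (dj : A) (x0 x1 y0 y1 h0 h1 g0 g1 : A) (z w : ℕ → A)
    (djx0 : ⁅dj, x0⁆ = 0) (djx1 : ⁅dj, x1⁆ = 0) (djy0 : ⁅dj, y0⁆ = 0) (djy1 : ⁅dj, y1⁆ = 0)
    (djz : ∀ s, ⁅dj, z s⁆ = z (s + 1)) (djw : ∀ s, ⁅dj, w s⁆ = -w (s + 1))
    (hxy : tbr θ x0 y0 = h0) (hx1y : tbr θ x1 y0 = h1) (hxy1 : tbr θ x0 y1 = h1)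
    (hzw : tbr η (z 0) (w 0) = g0) (hz1w : tbr η (z 1) (w 0) = g1)
    (djg0 : ⁅dj, g0⁆ = 0) (djg1 : ⁅dj, g1⁆ = 0)
    (hz : ⁅h0, z 0⁆ = α • z 0) (hw : ⁅h0, w 0⁆ = -(α • w 0)) (hg : ⁅h1, g1⁆ = 0)
    (hg0 : ⁅h1, g0⁆ = 0)
    (zy0 : ⁅z 0, y0⁆ = 0) (zy1 : ⁅z 0, y1⁆ = 0) (xw0 : ⁅x0, w 0⁆ = 0) (xw1 : ⁅x1, w 0⁆ = 0)
    (Rx : ⁅x1, z 0⁆ - ⁅x0, z 1⁆ = c • (x0 * z 0 + z 0 * x0) - b • ⁅x0, z 0⁆)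
    (Ry : ⁅y1, w 0⁆ - ⁅y0, w 1⁆ = -(c • (y0 * w 0 + w 0 * y0)) - b • ⁅y0, w 0⁆) :
    ⁅h1, tbr η (z 1) (w 1)⁆ = α • ⁅dj, tbr η (z 1) (w 1)⁆ ∧
      ⁅tbr θ x1 y1, g1⁆ = (2 * α) • ⁅dj, tbr η (z 1) (w 1)⁆ := by
  have djh0 : ⁅dj, h0⁆ = 0 := by
    rw [← hxy, lie_tbr, djx0, djy0]; simp [tbr]
  have djh1 : ⁅dj, h1⁆ = 0 := by
    rw [← hx1y, lie_tbr, djx1, djy0]; simp [tbr]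
  have djh2 : ⁅dj, tbr θ x1 y1⁆ = 0 := by
    rw [lie_tbr, djx1, djy1]; simp [tbr]
  have zy0' : ⁅z 1, y0⁆ = 0 := by
    simpa [ring_lie_lie, djz, djy0, ring_lie_zero] using congrArg (fun v => ⁅dj, v⁆) zy0
  have zy1' : ⁅z 1, y1⁆ = 0 := by
    simpa [ring_lie_lie, djz, djy1, ring_lie_zero] using congrArg (fun v => ⁅dj, v⁆) zy1
  have xw0' : ⁅x0, w 1⁆ = 0 := by
    simpa [ring_lie_lie, djw, djx0, ring_lie_zero, ring_zero_lie, ring_lie_neg]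
      using congrArg (fun v => ⁅dj, v⁆) xw0
  have xw1' : ⁅x1, w 1⁆ = 0 := by
    simpa [ring_lie_lie, djw, djx1, ring_lie_zero, ring_zero_lie, ring_lie_neg]
      using congrArg (fun v => ⁅dj, v⁆) xw1
  have neg_djw : ∀ s, ⁅-dj, w s⁆ = w (s + 1) := fun s => by rw [ring_neg_lie, djw, neg_neg]
  have neg_dj : ∀ v : A, ⁅dj, v⁆ = 0 → ⁅-dj, v⁆ = 0 := fun v hv => by rw [ring_neg_lie, hv, neg_zero]
  have Sx0 := exchange_propagate c b dj h0 h1 z djz djh0 djh1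
    (lie_of_exchange_left θ c b x0 x1 y0 _ _ _ _ zy0 zy0' Rx hxy hx1y)
  have Sx1 := exchange_propagate c b dj h1 _ z djz djh1 djh2
    (lie_of_exchange_left θ c b x0 x1 y1 _ _ _ _ zy1 zy1' Rx hxy1 rfl)
  have Sy0 := exchange_propagate (-c) b (-dj) h0 h1 w neg_djw (neg_dj _ djh0) (neg_dj _ djh1) (by
    rw [lie_of_exchange_right θ c b x0 y0 y1 _ _ _ _ xw0 xw0' Ry hxy hxy1]; module)
  have Sy1 := exchange_propagate (-c) b (-dj) h1 _ w neg_djw (neg_dj _ djh1) (neg_dj _ djh2) (by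
    rw [lie_of_exchange_right θ c b x1 y0 y1 _ _ _ _ xw1 xw1' Ry hx1y rfl]; module)
  have wz : ∀ s, ⁅h0, z s⁆ = α • z s := fun s => by
    induction s with
    | zero => exact hz
    | succ s ih =>
      simpa [ring_lie_lie, djz, djh0, ring_zero_lie, ring_lie_smul]
        using congrArg (fun v => ⁅dj, v⁆) ih
  have ww : ∀ s, ⁅h0, w s⁆ = -(α • w s) := fun s => by
    induction s with
    | zero => exact hw
    | succ s ih =>
      have := congrArg (fun v => ⁅-dj, v⁆) ih
      simpa [ring_lie_lie, neg_djw, neg_dj _ djh0, ring_zero_lie, ring_lie_smul, ring_lie_neg]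
        using this
  have weight : ∀ p q, ⁅h0, tbr η (z p) (w q)⁆ = 0 := fun p q => by
    rw [lie_tbr, wz, ww]
    simp only [tbr, smul_mul_assoc, mul_smul_comm, mul_neg, neg_mul]
    module
  have dV : ∀ p q, ⁅dj, tbr η (z p) (w q)⁆ = tbr η (z (p + 1)) (w q) - tbr η (z p) (w (q + 1)) :=
    fun p q => by
      rw [lie_tbr, djz, djw]
      simp only [tbr, mul_neg, neg_mul]
      module
  have v01 : tbr η (z 0) (w 1) = g1 := by
    have := dV 0 0
    rw [hzw, djg0, hz1w, eq_comm, sub_eq_zero] at this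
    exact this.symm
  have v20 : tbr η (z 2) (w 0) = tbr η (z 1) (w 1) := by
    have := dV 1 0
    rw [hz1w, djg1, eq_comm, sub_eq_zero] at this
    exact this
  have v02 : tbr η (z 0) (w 2) = tbr η (z 1) (w 1) := by
    have := dV 0 1
    rw [v01, djg1, eq_comm, sub_eq_zero] at this
    exact this.symm
  have key := lie_tbr_eq η c b α dj z w
    (fun k => match k with | 0 => h0 | 1 => h1 | _ => tbr θ x1 y1)
    (fun k => match k with | 0 => g0 | 1 => g1 | _ => tbr η (z 1) (w 1)) 2 2 wz ww djz djw
    (fun j hj => by interval_cases j <;> assumption)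
    (fun r hr s => by interval_cases r; exacts [Sx0 s, Sx1 s])
    (fun r hr s => by
      interval_cases r
      · exact (Sy0 s).trans (by simp only [neg_smul, ← sub_eq_add_neg])
      · exact (Sy1 s).trans (by simp only [neg_smul, ← sub_eq_add_neg]))
    (fun p q hpq => by
      have hp : p ≤ 2 := by omega
      have hq : q ≤ 2 := by omega
      interval_cases p <;> interval_cases q <;> first | omega | assumption | rfl)
    (fun k hk => by interval_cases k <;> assumption)
    (fun j hj k hk => by
      have hk' : k ≤ 2 := by omega
      interval_cases j
      · interval_cases k
        · exact hzw ▸ weight 0 0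
        · exact hz1w ▸ weight 1 0
        · exact weight 1 1
      · interval_cases k
        · exact hg0
        · exact hg
        · omega)
  constructor
  · simpa using key 1 (by norm_num) 1 1 (by norm_num)
  · have := key 2 (by norm_num) 1 0 (by norm_num)
    rw [hz1w] at this
    simpa using this

/-- For two adjacent nodes carrying commuting shift derivations, the shift derivation of a node
annihilates its second Cartan element. -/
theorem shift_lie_cartan_two (θ η c b α : ℂ) (hα : α ≠ 0) (di dj x0 y0 z0 w0 h0 h1 g0 g1 : A)
    (hdd : ⁅di, dj⁆ = 0) (djx : ⁅dj, x0⁆ = 0) (djy : ⁅dj, y0⁆ = 0) (diz : ⁅di, z0⁆ = 0)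
    (diw : ⁅di, w0⁆ = 0)
    (hxy : tbr θ x0 y0 = h0) (hx1y : tbr θ ⁅di, x0⁆ y0 = h1)
    (hzw : tbr η z0 w0 = g0) (hz1w : tbr η ⁅dj, z0⁆ w0 = g1)
    (dih0 : ⁅di, h0⁆ = 0) (dih1 : ⁅di, h1⁆ = 0) (djg0 : ⁅dj, g0⁆ = 0) (djg1 : ⁅dj, g1⁆ = 0)
    (hz : ⁅h0, z0⁆ = α • z0) (hw : ⁅h0, w0⁆ = -(α • w0))
    (gx : ⁅g0, x0⁆ = α • x0) (gy : ⁅g0, y0⁆ = -(α • y0))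
    (hg11 : ⁅h1, g1⁆ = 0) (hg10 : ⁅h1, g0⁆ = 0) (hg01 : ⁅g1, h0⁆ = 0)
    (zy : ⁅z0, y0⁆ = 0) (xw : ⁅x0, w0⁆ = 0)
    (Rx : ⁅⁅di, x0⁆, z0⁆ - ⁅x0, ⁅dj, z0⁆⁆ = c • (x0 * z0 + z0 * x0) - b • ⁅x0, z0⁆)
    (Ry : ⁅-⁅di, y0⁆, w0⁆ - ⁅y0, -⁅dj, w0⁆⁆ = -(c • (y0 * w0 + w0 * y0)) - b • ⁅y0, w0⁆) :
    ⁅di, tbr θ ⁅di, x0⁆ (-⁅di, y0⁆)⁆ = 0 := by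
  have hdd' : ⁅dj, di⁆ = 0 := by rw [ring_lie_skew, hdd, neg_zero]
  have shift (d v : A) (s : ℕ) : ⁅d, (fun u => ⁅d, u⁆)^[s] v⁆ = (fun u => ⁅d, u⁆)^[s + 1] v :=
    (Function.iterate_succ_apply' _ _ _).symm
  have shift_neg (d v : A) (s : ℕ) :
      ⁅d, (fun u => ⁅-d, u⁆)^[s] v⁆ = -(fun u => ⁅-d, u⁆)^[s + 1] v := by
    rw [Function.iterate_succ_apply', ring_neg_lie, neg_neg]
  have swap (d e v : A) (hde : ⁅d, e⁆ = 0) (hv : ⁅e, v⁆ = 0) : ⁅e, ⁅d, v⁆⁆ = 0 :=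
    iterate_lie_eq_zero d e v hde hv 1
  have hxy1 : tbr θ x0 (-⁅di, y0⁆) = h1 := by
    have := dih0
    rw [← hxy, lie_tbr, hx1y, add_eq_zero_iff_eq_neg] at this
    rw [this]; simp only [tbr, mul_neg, neg_mul]; module
  have hzw1 : tbr η z0 (-⁅dj, w0⁆) = g1 := by
    have := djg0
    rw [← hzw, lie_tbr, hz1w, add_eq_zero_iff_eq_neg] at this
    rw [this]; simp only [tbr, mul_neg, neg_mul]; module
  have A1 := cartan_lie_cartan θ η c b α dj x0 ⁅di, x0⁆ y0 (-⁅di, y0⁆) h0 h1 g0 g1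
    (fun s => (fun u => ⁅dj, u⁆)^[s] z0) (fun s => (fun u => ⁅-dj, u⁆)^[s] w0)
    djx (swap _ _ _ hdd djx) djy (by rw [ring_lie_neg, swap _ _ _ hdd djy, neg_zero])
    (shift dj z0) (shift_neg dj w0) hxy hx1y hxy1 hzw hz1w djg0 djg1 hz hw hg11 hg10 zy
    (by
      have := congrArg (fun v => ⁅di, v⁆) zy
      simpa [ring_lie_lie di, diz, ring_lie_zero, ring_zero_lie, ring_lie_neg] using this)
    xw
    (by
      have := congrArg (fun v => ⁅di, v⁆) xw
      simpa [ring_lie_lie di, diw, ring_lie_zero, ring_zero_lie] using this)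
    Rx (by simpa [ring_neg_lie] using Ry)
  have A2 := cartan_lie_cartan η θ c (-b) α di z0 ⁅dj, z0⁆ w0 (-⁅dj, w0⁆) g0 g1 h0 h1
    (fun s => (fun u => ⁅di, u⁆)^[s] x0) (fun s => (fun u => ⁅-di, u⁆)^[s] y0)
    diz (swap _ _ _ hdd' diz) diw (by rw [ring_lie_neg, swap _ _ _ hdd' diw, neg_zero])
    (shift di x0) (shift_neg di y0) hzw hz1w hzw1 hxy hx1y dih0 dih1 gx gy
    (by rw [ring_lie_skew, hg11, neg_zero]) hg01 xw
    (by
      have := congrArg (fun v => ⁅dj, v⁆) xw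
      simpa [ring_lie_lie dj, djx, ring_lie_zero, ring_zero_lie, ring_lie_neg] using this)
    zy
    (by
      have := congrArg (fun v => ⁅dj, v⁆) zy
      simpa [ring_lie_lie dj, djy, ring_lie_zero, ring_zero_lie] using this)
    (by
      simp only [Function.iterate_zero, Function.iterate_one, id]
      rw [ring_lie_skew _ x0, ring_lie_skew z0 ⁅di, x0⁆, ring_lie_skew z0 x0]
      linear_combination (norm := module) Rx)
    (by
      simp only [Function.iterate_zero, Function.iterate_one, id, ring_neg_lie] at Ry ⊢
      rw [ring_lie_neg] at Ry ⊢
      rw [ring_lie_skew _ y0, ring_lie_skew w0 ⁅di, y0⁆, ring_lie_skew w0 y0]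
      linear_combination (norm := module) Ry)
  simp only [Function.iterate_one, ring_neg_lie] at A1 A2
  obtain ⟨a1, a2⟩ := A1
  obtain ⟨b1, b2⟩ := A2
  rw [ring_lie_skew, b1] at a2
  rw [ring_lie_skew, a1] at b2
  set u := ⁅di, tbr θ ⁅di, x0⁆ (-⁅di, y0⁆)⁆
  set v := ⁅dj, tbr η ⁅dj, z0⁆ (-⁅dj, w0⁆)⁆
  have : (3 * α) • u = 0 := by
    linear_combination (norm := module) a2 - (2 : ℂ) • b2
  exact (smul_eq_zero.mp this).resolve_left (by simpa using hα)

/-- The defect of the quadratic exchange relation between modes of a single root vector. -/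
def exchangeDefect (c : ℂ) (x : ℕ → A) (r s : ℕ) : A :=
  ⁅x (r + 1), x s⁆ - ⁅x r, x (s + 1)⁆ - c • (x r * x s + x s * x r)

/-- The defect of the relation between Cartan modes and modes of a root vector. -/
def cartanDefect (c : ℂ) (h x : ℕ → A) (r s : ℕ) : A :=
  ⁅h (r + 1), x s⁆ - ⁅h r, x (s + 1)⁆ - c • (h r * x s + x s * h r)

theorem exchangeDefect_comm (c : ℂ) (x : ℕ → A) (r s : ℕ) :
    exchangeDefect c x r s = exchangeDefect c x s r := by
  simp only [exchangeDefect, Ring.lie_def]; module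

theorem lie_exchangeDefect (c : ℂ) (t : A) (x : ℕ → A) (dx : ∀ s, ⁅t, x s⁆ = x (s + 1))
    (r s : ℕ) :
    ⁅t, exchangeDefect c x r s⁆ = exchangeDefect c x (r + 1) s + exchangeDefect c x r (s + 1) := by
  simp only [exchangeDefect, ring_lie_sub, ring_lie_smul, ring_lie_add, ring_lie_mul,
    ring_lie_lie t, dx]
  module

theorem lie_exchangeDefect_two (c e : ℂ) (t : A) (x : ℕ → A)
    (dx : ∀ s, ⁅t, x s⁆ = x (s + 2) + e • x s) (r s : ℕ) :
    ⁅t, exchangeDefect c x r s⁆ = exchangeDefect c x (r + 2) s + exchangeDefect c x r (s + 2)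
      + (2 * e) • exchangeDefect c x r s := by
  have h1 : r + 1 + 2 = r + 2 + 1 := by omega
  have h2 : s + 1 + 2 = s + 2 + 1 := by omega
  simp only [exchangeDefect, ring_lie_sub, ring_lie_smul, ring_lie_add, ring_lie_mul,
    ring_lie_lie t, dx, ring_add_lie, ring_smul_lie, add_mul, mul_add, smul_mul_assoc,
    mul_smul_comm, h1, h2]
  module

theorem eq_zero_of_add_self (v : A) (h : v + v = 0) : v = 0 := by
  have : (2 : ℂ) • v = 0 := by rw [two_smul, h]
  exact (smul_eq_zero.mp this).resolve_left two_ne_zero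

theorem exchangeDefect_one (c : ℂ) (t : A) (x : ℕ → A) (dx : ∀ s, ⁅t, x s⁆ = x (s + 1))
    (h : exchangeDefect c x 0 0 = 0) : exchangeDefect c x 1 0 = 0 := by
  have := lie_exchangeDefect c t x dx 0 0
  rw [h, ring_lie_zero, exchangeDefect_comm c x 0 (0 + 1)] at this
  exact eq_zero_of_add_self _ this.symm

theorem exchangeDefect_eq_zero (c e : ℂ) (t t2 : A) (x : ℕ → A)
    (dx : ∀ s, ⁅t, x s⁆ = x (s + 1)) (dx2 : ∀ s, ⁅t2, x s⁆ = x (s + 2) + e • x s)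
    (h : exchangeDefect c x 0 0 = 0) (r s : ℕ) : exchangeDefect c x r s = 0 := by
  suffices H : ∀ k r s, r + s ≤ k → exchangeDefect c x r s = 0 from H _ r s le_rfl
  have shift : ∀ r s, exchangeDefect c x r s = 0 →
      exchangeDefect c x (r + 1) s = -exchangeDefect c x r (s + 1) := fun r s hrs => by
    have := lie_exchangeDefect c t x dx r s
    rw [hrs, ring_lie_zero] at this
    exact eq_neg_of_add_eq_zero_left this.symm
  intro k
  induction k with
  | zero =>
    intro r s hrs
    obtain ⟨rfl, rfl⟩ : r = 0 ∧ s = 0 := by omega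
    exact h
  | succ k ih =>
    have base : exchangeDefect c x 0 (k + 1) = 0 := by
      rcases k with _ | k
      · rw [exchangeDefect_comm]
        exact exchangeDefect_one c t x dx h
      · have e1 := lie_exchangeDefect_two c e t2 x dx2 0 k
        have e2 := shift 1 k (ih 1 k (by omega))
        rw [shift 0 (k + 1) (ih 0 (k + 1) (by omega)), neg_neg] at e2
        rw [ih 0 k (by omega), ring_lie_zero, smul_zero, add_zero, e2] at e1
        exact eq_zero_of_add_self _ e1.symm
    intro r
    induction r with
    | zero =>
      intro s hs
      rcases hs.lt_or_eq with hs | hs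
      · exact ih 0 s (by omega)
      · obtain rfl : s = k + 1 := by omega
        exact base
    | succ r ihr =>
      intro s hs
      rw [shift r s (ih r s (by omega)), ihr (s + 1) (by omega), neg_zero]

theorem cartanDefect_add_comm (c σ : ℂ) (hσ : σ ≠ 0) (x h : ℕ → A) (y : A) (r s : ℕ)
    (hr : ⁅x r, y⁆ = σ • h r) (hr' : ⁅x (r + 1), y⁆ = σ • h (r + 1))
    (hs : ⁅x s, y⁆ = σ • h s) (hs' : ⁅x (s + 1), y⁆ = σ • h (s + 1))
    (hR : exchangeDefect c x r s = 0) : cartanDefect c h x r s + cartanDefect c h x s r = 0 := by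
  have key : ⁅y, exchangeDefect c x r s⁆
      = (-σ) • (cartanDefect c h x r s + cartanDefect c h x s r) := by
    rw [ring_lie_skew, neg_eq_iff_eq_neg] at hr hr' hs hs'
    simp only [exchangeDefect, cartanDefect, ring_lie_sub, ring_lie_smul, ring_lie_add,
      ring_lie_mul, ring_lie_lie y, hr, hr', hs, hs']
    simp only [Ring.lie_def, smul_mul_assoc, mul_smul_comm, neg_mul, mul_neg]
    module
  rw [hR, ring_lie_zero] at key
  exact (smul_eq_zero.mp key.symm).resolve_left (neg_ne_zero.mpr hσ)

theorem cartanDefect_propagate (c : ℂ) (t : A) (x h : ℕ → A) (dx : ∀ s, ⁅t, x s⁆ = x (s + 1))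
    (r : ℕ) (hr : ⁅t, h r⁆ = 0) (hr' : ⁅t, h (r + 1)⁆ = 0) (h0 : cartanDefect c h x r 0 = 0)
    (s : ℕ) : cartanDefect c h x r s = 0 := by
  induction s with
  | zero => exact h0
  | succ s ih =>
    have := congrArg (fun v => ⁅t, v⁆) ih
    simpa only [cartanDefect, ring_lie_sub, ring_lie_smul, ring_lie_add, ring_lie_mul,
      ring_lie_lie t, hr, hr', dx, ring_zero_lie, zero_mul, mul_zero, zero_add, add_zero,
      ring_lie_zero] using this

theorem cartanDefect_zero (a κ : ℂ) (t : A) (x h : ℕ → A) (dx : ∀ s, ⁅t, x s⁆ = x (s + 1))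
    (h1 : h 1 = a • t + κ • (h 0 * h 0)) (hx : ∀ s, ⁅h 0, x s⁆ = a • x s) (s : ℕ) :
    cartanDefect (a * κ) h x 0 s = 0 := by
  simp only [cartanDefect, zero_add, h1, ring_add_lie, ring_smul_lie, ring_mul_lie, hx, dx,
    smul_mul_assoc, mul_smul_comm]
  module

theorem lie_second_cartan (a κ : ℂ) (ha : a ≠ 0) (x h : ℕ → A) (hx : ∀ s, ⁅h 0, x s⁆ = a • x s)
    (S0 : ∀ s, cartanDefect (a * κ) h x 0 s = 0) (S1 : ∀ s, cartanDefect (a * κ) h x 1 s = 0)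
    (s : ℕ) :
    ⁅a⁻¹ • (h 2 - κ • (h 0 * h 1 + h 1 * h 0) + (4 / 3 * κ ^ 2) • (h 0 * (h 0 * h 0))), x s⁆
      = x (s + 2) + (κ ^ 2 * a ^ 2 / 3) • x s := by
  have e1 : ⁅h 2, x s⁆ = ⁅h 1, x (s + 1)⁆ + (a * κ) • (h 1 * x s + x s * h 1) := by
    linear_combination (norm := (simp only [cartanDefect]; module)) S1 s
  have e2 : ⁅h 1, x (s + 1)⁆
      = a • x (s + 2) + (a * κ) • (h 0 * x (s + 1) + x (s + 1) * h 0) := by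
    rw [← hx]
    linear_combination (norm := (simp only [cartanDefect]; module)) S0 (s + 1)
  have e3 : a • x (s + 1) = ⁅h 1, x s⁆ - (a * κ) • (h 0 * x s + x s * h 0) := by
    rw [← hx]
    linear_combination (norm := (simp only [cartanDefect]; module)) - S0 s
  have e4 : (a * κ) • (h 0 * x (s + 1) + x (s + 1) * h 0)
      = κ • (h 0 * (⁅h 1, x s⁆ - (a * κ) • (h 0 * x s + x s * h 0))
        + (⁅h 1, x s⁆ - (a * κ) • (h 0 * x s + x s * h 0)) * h 0) := by
    rw [← e3]
    simp only [smul_mul_assoc, mul_smul_comm]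
    module
  have e5 : h 0 * x s = x s * h 0 + a • x s := by
    rw [← hx, Ring.lie_def]; abel
  have e6 : ⁅h 2 - κ • (h 0 * h 1 + h 1 * h 0) + (4 / 3 * κ ^ 2) • (h 0 * (h 0 * h 0)), x s⁆
      = a • x (s + 2) + (κ ^ 2 * a ^ 3 / 3) • x s := by
    have e5' : ∀ v, h 0 * (x s * v) = x s * (h 0 * v) + a • (x s * v) := fun v => by
      rw [← mul_assoc, e5, add_mul, smul_mul_assoc, mul_assoc]
    rw [ring_add_lie, ring_sub_lie, e1, e2, e4]
    simp only [ring_smul_lie, ring_add_lie, ring_mul_lie, hx]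
    simp only [Ring.lie_def, mul_add, add_mul, mul_sub, sub_mul, smul_mul_assoc, mul_smul_comm,
      mul_assoc, e5, e5', smul_add]
    module
  rw [ring_smul_lie, e6, smul_add, smul_smul, smul_smul, inv_mul_cancel₀ ha, one_smul]
  congr 2
  field_simp

/-- If the shift `t` kills the Cartan modes up to degree two, all quadratic exchange relations of
a root vector hold. -/
theorem exchangeDefect_eq_zero_of_lie_cartan (a κ σ : ℂ) (ha : a ≠ 0) (hσ : σ ≠ 0) (t y : A)
    (x h : ℕ → A) (dx : ∀ s, ⁅t, x s⁆ = x (s + 1)) (h1 : h 1 = a • t + κ • (h 0 * h 0))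
    (hx : ∀ s, ⁅h 0, x s⁆ = a • x s) (dh : ∀ k ≤ 2, ⁅t, h k⁆ = 0)
    (hxy : ∀ r ≤ 2, ⁅x r, y⁆ = σ • h r) (hR : exchangeDefect (a * κ) x 0 0 = 0) (r s : ℕ) :
    exchangeDefect (a * κ) x r s = 0 := by
  have S0 := cartanDefect_zero a κ t x h dx h1 hx
  have S1 : cartanDefect (a * κ) h x 1 0 = 0 := by
    have := cartanDefect_add_comm (a * κ) σ hσ x h y 1 0 (hxy _ (by norm_num))
      (hxy _ (by norm_num)) (hxy _ (by norm_num)) (hxy _ (by norm_num))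
      (exchangeDefect_one _ t x dx hR)
    rwa [S0, add_zero] at this
  exact exchangeDefect_eq_zero _ _ t _ x dx (lie_second_cartan a κ ha x h hx S0
    (cartanDefect_propagate _ t x h dx 1 (dh 1 (by norm_num)) (dh 2 le_rfl) S1)) hR r s

theorem lie_modes_eq {R : Type*} [Ring R] (t : R) (x y h : ℕ → R) (dx : ∀ s, ⁅t, x s⁆ = x (s + 1))
    (dy : ∀ s, ⁅t, y s⁆ = -y (s + 1)) (hxy : ∀ r, ⁅x r, y 0⁆ = h r) (N : ℕ)
    (dh : ∀ k < N, ⁅t, h k⁆ = 0) (p q : ℕ) (hpq : p + q ≤ N) : ⁅x p, y q⁆ = h (p + q) := by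
  induction q generalizing p with
  | zero => exact hxy p
  | succ q ih =>
    have e := congrArg (fun v => ⁅t, v⁆) (ih p (by omega))
    simp only [ring_lie_lie t, dx, dy, dh _ (show p + q < N by omega), ring_lie_neg] at e
    rw [ih (p + 1) (by omega), ← sub_eq_add_neg, sub_eq_zero] at e
    rw [← e]
    congr 1; omega

theorem cartanDefect_eq_zero (a κ σ : ℂ) (hσ : σ ≠ 0) (t y : A)
    (x h : ℕ → A) (dx : ∀ s, ⁅t, x s⁆ = x (s + 1)) (h1 : h 1 = a • t + κ • (h 0 * h 0))
    (hx : ∀ s, ⁅h 0, x s⁆ = a • x s) (N : ℕ) (hN : 1 ≤ N) (dh : ∀ k ≤ N, ⁅t, h k⁆ = 0)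
    (hxy : ∀ r ≤ N, ⁅x r, y⁆ = σ • h r) (hR : ∀ r s, exchangeDefect (a * κ) x r s = 0) (r s : ℕ)
    (hr : r < N) : cartanDefect (a * κ) h x r s = 0 := by
  refine cartanDefect_propagate _ t x h dx r (dh r hr.le) (dh _ hr) ?_ s
  have := cartanDefect_add_comm (a * κ) σ hσ x h y r 0 (hxy _ hr.le) (hxy _ hr)
    (hxy _ (by omega)) (hxy _ hN) (hR _ _)
  rwa [cartanDefect_zero a κ t x h dx h1 hx, add_zero] at this

/-- The data of a single even node: the shift `t` acts on the root vectors, and the Cartan modes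
are commuting and killed by `t` as soon as this holds for the first three of them. -/
theorem lie_cartan_eq_zero (a κ : ℂ) (ha : a ≠ 0) (t : A) (x y h : ℕ → A)
    (dx : ∀ s, ⁅t, x s⁆ = x (s + 1)) (dy : ∀ s, ⁅t, y s⁆ = -y (s + 1))
    (h1 : h 1 = a • t + κ • (h 0 * h 0)) (hx : ∀ s, ⁅h 0, x s⁆ = a • x s)
    (hy : ∀ s, ⁅h 0, y s⁆ = -(a • y s)) (hxy : ∀ r, ⁅x r, y 0⁆ = h r)
    (dh : ∀ k ≤ 2, ⁅t, h k⁆ = 0) (hRx : exchangeDefect (a * κ) x 0 0 = 0)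
    (hRy : exchangeDefect (-a * κ) y 0 0 = 0) :
    (∀ r s, exchangeDefect (a * κ) x r s = 0) ∧ (∀ r s, exchangeDefect (-a * κ) y r s = 0) ∧
      (∀ k, ⁅t, h k⁆ = 0) ∧ (∀ j k, ⁅h j, h k⁆ = 0) := by
  have dy' : ∀ s, ⁅-t, y s⁆ = y (s + 1) := fun s => by rw [ring_neg_lie, dy, neg_neg]
  have h1' : h 1 = (-a) • (-t) + κ • (h 0 * h 0) := by rw [h1, neg_smul, smul_neg, neg_neg]
  have hy' : ∀ s, ⁅h 0, y s⁆ = (-a) • y s := fun s => by rw [hy, neg_smul]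
  have dh' : ∀ N, (∀ k ≤ N, ⁅t, h k⁆ = 0) → ∀ k ≤ N, ⁅-t, h k⁆ = 0 := fun N H k hk => by
    rw [ring_neg_lie, H k hk, neg_zero]
  have hyx : ∀ N, (∀ k ≤ N, ⁅t, h k⁆ = 0) → ∀ r ≤ N, ⁅y r, x 0⁆ = (-1 : ℂ) • h r :=
    fun N H r hr => by
      rw [ring_lie_skew, lie_modes_eq t x y h dx dy hxy N (fun k hk => H k hk.le) 0 r (by omega),
        zero_add, neg_one_smul]
  have hxy' : ∀ r, ⁅x r, y 0⁆ = (1 : ℂ) • h r := fun r => by rw [hxy, one_smul]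
  have RX := exchangeDefect_eq_zero_of_lie_cartan a κ 1 ha one_ne_zero t (y 0) x h dx h1 hx dh
    (fun r _ => hxy' r) hRx
  have RY := exchangeDefect_eq_zero_of_lie_cartan (-a) κ (-1) (neg_ne_zero.mpr ha) (by norm_num)
    (-t) (x 0) y h dy' h1' hy' (dh' 2 dh) (hyx 2 dh) hRy
  have weight : ∀ k, ⁅h 0, h k⁆ = 0 := fun k => by
    rw [← hxy k, ring_lie_lie, hx, hy, ring_smul_lie, ring_lie_neg, ring_lie_smul, add_neg_cancel]
  have key : ∀ N, 2 ≤ N → (∀ k ≤ N, ⁅t, h k⁆ = 0) ∧ (∀ j k, j + k ≤ N + 1 → ⁅h j, h k⁆ = 0) := by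
    intro N hN
    induction N, hN using Nat.le_induction with
    | base =>
      refine ⟨dh, fun j k hjk => ?_⟩
      have h1k : ∀ k ≤ 2, ⁅h 1, h k⁆ = 0 := fun k hk => by
        rw [h1, ring_add_lie, ring_smul_lie, ring_smul_lie, ring_mul_lie, dh k hk, weight]
        simp
      obtain rfl | rfl | ⟨hj, hk⟩ | ⟨hj, hk⟩ :
        j = 0 ∨ j = 1 ∨ (j ≤ 3 ∧ k = 0) ∨ (j ≤ 2 ∧ k = 1) := by omega
      · exact weight k
      · exact h1k k (by omega)
      · rw [hk, ring_lie_skew, weight, neg_zero]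
      · rw [hk, ring_lie_skew, h1k j hj, neg_zero]
    | succ N hN ih =>
      obtain ⟨D, C⟩ := ih
      have V := lie_modes_eq t x y h dx dy hxy (N + 1) (fun k hk => D k (by omega))
      have SX := cartanDefect_eq_zero a κ 1 one_ne_zero t (y 0) x h dx h1 hx N (by omega) D
        (fun r _ => hxy' r) RX
      have SY := cartanDefect_eq_zero (-a) κ (-1) (by norm_num) (-t) (x 0) y h dy' h1' hy' N
        (by omega) (dh' N D) (hyx N D) RY
      have L : ∀ j ≤ N, ∀ p q, j + p + q = N + 2 →
          ⁅h j, ⁅x p, y q⁆⁆ = ((j : ℂ) * a) • ⁅t, h (N + 1)⁆ := fun j hj p q hpq => by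
        have := lie_tbr_eq 1 (a * κ) 0 a t x y h h N (N + 1) hx hy dx dy
          (fun j hj => D j hj.le)
          (fun r hr s => by
            linear_combination (norm := (simp only [cartanDefect]; module)) SX r s hr)
          (fun r hr s => by
            linear_combination (norm := (simp only [cartanDefect]; module)) SY r s hr)
          (fun p q hpq => by rw [← V p q hpq, tbr, one_smul, Ring.lie_def])
          (fun k hk => D k (by omega))
          (fun j hj k hjk => C j k hjk) j hj p q hpq
        rwa [tbr, one_smul, ← Ring.lie_def] at this
      have L' : ∀ j ≤ N, ∀ k, j + k = N + 2 → ⁅h j, h k⁆ = ((j : ℂ) * a) • ⁅t, h (N + 1)⁆ :=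
        fun j hj k hk => by rw [← hxy k]; exact L j hj k 0 (by omega)
      have u0 : ⁅t, h (N + 1)⁆ = 0 := by
        have e1 := L' 2 hN N (by omega)
        rw [ring_lie_skew, L' N le_rfl 2 (by omega)] at e1
        have : (((N + 2 : ℕ) : ℂ) * a) • ⁅t, h (N + 1)⁆ = 0 := by
          push_cast at e1 ⊢
          linear_combination (norm := module) -e1
        exact (smul_eq_zero.mp this).resolve_left
          (mul_ne_zero (Nat.cast_ne_zero.mpr (by omega)) ha)
      refine ⟨fun k hk => ?_, fun j k hjk => ?_⟩
      · rcases hk.lt_or_eq with hk | rfl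
        · exact D k (by omega)
        · exact u0
      · rcases hjk.lt_or_eq with hjk | hjk
        · exact C j k (by omega)
        · rcases le_or_gt j N with hj | hj
          · rw [L' j hj k (by omega), u0, smul_zero]
          · rw [ring_lie_skew, L' k (by omega) j (by omega), u0, smul_zero, neg_zero]
  exact ⟨RX, RY, fun k => (key (k + 2) (by omega)).1 k (by omega),
    fun j k => (key (j + k + 2) (by omega)).2 j k (by omega)⟩

section

variable {m n : ℕ} {ε₁ ε₂ : ℂ}

theorem ppar_eq_zero_or_one (m n : ℕ) (i : ZMod (m + n)) : ppar m n i = 0 ∨ ppar m n i = 1 := by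
  unfold ppar; split_ifs <;> simp

theorem ppar_add_one (hm : 2 ≤ m) (hn : 2 ≤ n) (i : ZMod (m + n)) (h0 : i ≠ 0)
    (hmm : i ≠ (m : ZMod (m + n))) : ppar m n (i + 1) = ppar m n i := by
  have : NeZero (m + n) := ⟨by omega⟩
  have hv : i.val ≠ 0 := by rwa [Ne, ZMod.val_eq_zero]
  have hvm : i.val ≠ m := fun h => hmm (by
    rw [← ZMod.natCast_zmod_val i, h])
  have hlt := ZMod.val_lt i
  have : Fact (1 < m + n) := ⟨by omega⟩
  have hs : (i + 1).val = (i.val + 1) % (m + n) := by rw [ZMod.val_add, ZMod.val_one]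
  have : (i + 1).val = if i.val + 1 = m + n then 0 else i.val + 1 := by
    rw [hs]
    split_ifs with h
    · rw [h, Nat.mod_self]
    · exact Nat.mod_eq_of_lt (by omega)
  unfold ppar
  rw [this]
  split_ifs <;> omega

theorem sgn_ppar_sq (m n : ℕ) (i : ZMod (m + n)) :
    ((-1 : ℂ) ^ ppar m n i) * (-1) ^ ppar m n i = 1 := by
  rcases ppar_eq_zero_or_one m n i with h | h <;> rw [h] <;> norm_num

theorem add_one_ne_self (hm : 2 ≤ m) (i : ZMod (m + n)) : i + 1 ≠ i := by
  have : Fact (1 < m + n) := ⟨by omega⟩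
  simp

theorem two_ne_zero_zmod (hm : 2 ≤ m) (hn : 2 ≤ n) : (2 : ZMod (m + n)) ≠ 0 := by
  intro h
  have h' : ((2 : ℕ) : ZMod (m + n)) = 0 := by exact_mod_cast h
  rw [ZMod.natCast_eq_zero_iff] at h'
  have := Nat.le_of_dvd (by norm_num) h'
  omega

theorem aC_self (i : ZMod (m + n)) :
    aC m n i i = (-1) ^ ppar m n i + (-1) ^ ppar m n (i + 1) := by
  simp [aC, aZ]

theorem aC_add_one_right (hm : 2 ≤ m) (i : ZMod (m + n)) :
    aC m n i (i + 1) = -(-1) ^ ppar m n (i + 1) := by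
  simp [aC, aZ, (add_one_ne_self (n := n) hm i).symm]

theorem aC_add_one_left (hm : 2 ≤ m) (hn : 2 ≤ n) (i : ZMod (m + n)) :
    aC m n (i + 1) i = -(-1) ^ ppar m n (i + 1) := by
  have h : i ≠ i + 1 + 1 := by
    intro h
    apply two_ne_zero_zmod hm hn
    have : i + 0 = i + 2 := by rw [add_zero]; nth_rewrite 1 [h]; ring
    exact (add_left_cancel this).symm
  simp [aC, aZ, add_one_ne_self (n := n) hm i, h]

theorem bC_self (hm : 2 ≤ m) (i : ZMod (m + n)) : bC m n i i = 0 := by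
  have h1 : ¬ (i = ((m + n - 1 : ℕ) : ZMod (m + n)) ∧ i = 0) := by
    rintro ⟨h, rfl⟩
    rw [eq_comm, ZMod.natCast_eq_zero_iff] at h
    have := Nat.le_of_dvd (by omega) h
    omega
  have h2 : i ≠ i - 1 := fun h => by
    apply add_one_ne_self (n := n) hm i
    nth_rewrite 1 [h]
    ring
  rw [bC, if_neg h1, if_neg (add_one_ne_self hm i).symm, if_neg h2]

theorem gpar_eq_zero (hm : 2 ≤ m) (hn : 2 ≤ n) (i : ZMod (m + n)) (h0 : i ≠ 0)
    (hmm : i ≠ (m : ZMod (m + n))) : gpar m n i = 0 := by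
  rw [gpar, ppar_add_one hm hn i h0 hmm]; omega

theorem sbr_zero_left (q : ℕ) (x y : A) : sbr 0 q x y = ⁅x, y⁆ := by
  simp [sbr, Ring.lie_def]

theorem sbr_zero_right (q : ℕ) (x y : A) : sbr q 0 x y = ⁅x, y⁆ := by
  simp [sbr, Ring.lie_def]

theorem sbr_eq_tbr (p q : ℕ) (x y : A) : sbr p q x y = tbr ((-1) ^ (p * q)) x y := rfl

theorem htld_lie_X (R : YtildeRep m n ε₁ ε₂ A) (b : Bool) (i j : ZMod (m + n)) :
    ⁅htld m n ε₁ ε₂ R.H i, R.X b j 0⁆ =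
      (sgn b * aC m n i j) • (R.X b j 1 - (bC m n i j * ((ε₁ - ε₂) / 2)) • R.X b j 0) := by
  rw [Ring.lie_def, R.rel25]

theorem H_zero_lie_X (R : YtildeRep m n ε₁ ε₂ A) (b : Bool) (i j : ZMod (m + n)) (r : ℕ)
    (hr : r ≤ 1) : ⁅R.H i 0, R.X b j r⁆ = (sgn b * aC m n i j) • R.X b j r := by
  rw [Ring.lie_def, R.rel24 b i j r hr]

/-- A symmetric `2 × 2` block of the Cartan matrix with nonzero determinant yields a combination
of Cartan elements shifting the root vectors of the first node and annihilating those of the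
second one. -/
theorem exists_shift (R : YtildeRep m n ε₁ ε₂ A) (i j : ZMod (m + n)) (hi : bC m n i i = 0)
    (hj : bC m n j j = 0) (hs : aC m n j i = aC m n i j)
    (hδ : aC m n i i * aC m n j j - aC m n i j * aC m n i j ≠ 0) :
    ∃ p q r s : ℂ, ∀ b,
      ⁅p • htld m n ε₁ ε₂ R.H i + q • htld m n ε₁ ε₂ R.H j + r • R.H i 0 + s • R.H j 0,
          R.X b i 0⁆ = sgn b • R.X b i 1 ∧
      ⁅p • htld m n ε₁ ε₂ R.H i + q • htld m n ε₁ ε₂ R.H j + r • R.H i 0 + s • R.H j 0,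
          R.X b j 0⁆ = 0 := by
  set aii := aC m n i i
  set ajj := aC m n j j
  set α := aC m n i j
  set δ := aii * ajj - α * α with hδdef
  have cramer : ∀ u v : ℂ, ∃ p q : ℂ, p * aii + q * α = u ∧ p * α + q * ajj = v := fun u v =>
    ⟨(u * ajj - α * v) / δ, (aii * v - α * u) / δ, by field_simp; rw [hδdef]; ring,
      by field_simp; rw [hδdef]; ring⟩
  obtain ⟨p, q, h1, h2⟩ := cramer 1 0
  obtain ⟨r, s, h3, h4⟩ := cramer (q * α * bC m n j i * ((ε₁ - ε₂) / 2))
    (p * α * bC m n i j * ((ε₁ - ε₂) / 2))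
  refine ⟨p, q, r, s, fun b => ?_⟩
  simp only [ring_add_lie, ring_smul_lie, htld_lie_X, H_zero_lie_X R _ _ _ 0 zero_le_one, hi,
    hj, hs]
  constructor
  · linear_combination (norm := module) sgn b • congrArg (fun z => z • R.X b i 1) h1 +
      sgn b • congrArg (fun z => z • R.X b i 0) h3
  · linear_combination (norm := module) sgn b • congrArg (fun z => z • R.X b j 1) h2 +
      sgn b • congrArg (fun z => z • R.X b j 0) h4

theorem lie_H_H (R : YtildeRep m n ε₁ ε₂ A) (i j : ZMod (m + n)) (r s : ℕ) (hr : r ≤ 1)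
    (hs : s ≤ 1) : ⁅R.H i r, R.H j s⁆ = 0 := by
  rw [Ring.lie_def, R.rel21 i j r s hr hs, sub_self]

theorem htld_lie_H (R : YtildeRep m n ε₁ ε₂ A) (i j : ZMod (m + n)) (s : ℕ) (hs : s ≤ 1) :
    ⁅htld m n ε₁ ε₂ R.H i, R.H j s⁆ = 0 := by
  rw [htld, ring_sub_lie, ring_smul_lie, ring_mul_lie, lie_H_H R i j 1 s le_rfl hs,
    lie_H_H R i j 0 s zero_le_one hs]
  simp

/-- The shift derivation of an even node annihilates `[x⁺_{i,1}, x⁻_{i,1}]`. -/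
theorem htld_lie_tbr (R : YtildeRep m n ε₁ ε₂ A) (i j : ZMod (m + n)) (hij : i ≠ j)
    (hg : gpar m n i = 0) (hi : bC m n i i = 0) (hj : bC m n j j = 0)
    (hs : aC m n j i = aC m n i j) (hα : aC m n i j ≠ 0)
    (hδ : aC m n i i * aC m n j j - aC m n i j * aC m n i j ≠ 0) :
    ⁅htld m n ε₁ ε₂ R.H i, tbr 1 (R.X true i 1) (R.X false i 1)⁆ = 0 := by
  obtain ⟨p, q, r, s, hd⟩ := exists_shift R i j hi hj hs hδ
  obtain ⟨p', q', r', s', hd'⟩ := exists_shift R j i hj hi hs.symm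
    (by rwa [hs, mul_comm (aC m n j j)])
  have comm : ∀ (k l : ZMod (m + n)) (p q r s : ℂ) (v : A),
      (∀ i u, u ≤ 1 → ⁅R.H i u, v⁆ = 0) →
      ⁅p • htld m n ε₁ ε₂ R.H k + q • htld m n ε₁ ε₂ R.H l + r • R.H k 0 + s • R.H l 0, v⁆ = 0 :=
    fun k l p q r s v hv => by
      simp only [ring_add_lie, ring_smul_lie, htld, ring_sub_lie, ring_mul_lie,
        hv _ 1 le_rfl, hv _ 0 zero_le_one, smul_zero, mul_zero, zero_mul, add_zero, sub_zero]
  have dH : ∀ (k l j : ZMod (m + n)) (p q r s : ℂ) (u : ℕ), u ≤ 1 →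
      ⁅p • htld m n ε₁ ε₂ R.H k + q • htld m n ε₁ ε₂ R.H l + r • R.H k 0 + s • R.H l 0,
        R.H j u⁆ = 0 :=
    fun k l j p q r s u hu => comm k l p q r s _ fun i v hv => lie_H_H R i j v u hv hu
  have dd : ∀ (k l j j' : ZMod (m + n)) (p q r s p' q' r' s' : ℂ),
      ⁅p • htld m n ε₁ ε₂ R.H k + q • htld m n ε₁ ε₂ R.H l + r • R.H k 0 + s • R.H l 0,
        p' • htld m n ε₁ ε₂ R.H j + q' • htld m n ε₁ ε₂ R.H j' + r' • R.H j 0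
          + s' • R.H j' 0⁆ = 0 :=
    fun k l j j' p q r s p' q' r' s' => comm k l p q r s _ fun i v hv => by
      rw [ring_lie_skew, dH _ _ _ _ _ _ _ _ hv, neg_zero]
  set di := p • htld m n ε₁ ε₂ R.H i + q • htld m n ε₁ ε₂ R.H j + r • R.H i 0 + s • R.H j 0
  set dj := p' • htld m n ε₁ ε₂ R.H j + q' • htld m n ε₁ ε₂ R.H i + r' • R.H j 0 + s' • R.H i 0
  have dix : ⁅di, R.X true i 0⁆ = R.X true i 1 := by rw [(hd true).1]; simp [sgn]
  have diy : ⁅di, R.X false i 0⁆ = -R.X false i 1 := by rw [(hd false).1]; simp [sgn]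
  have djz : ⁅dj, R.X true j 0⁆ = R.X true j 1 := by rw [(hd' true).1]; simp [sgn]
  have djw : ⁅dj, R.X false j 0⁆ = -R.X false j 1 := by rw [(hd' false).1]; simp [sgn]
  have r22 := R.rel22 i i
  have r23 := R.rel23a i i
  have r22j := R.rel22 j j
  have r23j := R.rel23a j j
  have zy := R.rel22 j i
  have xw := R.rel22 i j
  have Rx := R.rel26 true i j
  have Ry := R.rel26 false i j
  simp only [hg, sbr_zero_left, sbr_zero_right, if_true, if_neg hij,
    if_neg hij.symm] at r22 r23 zy xw Rx Ry
  simp only [if_true] at r22j r23j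
  have key := shift_lie_cartan_two 1 ((-1) ^ (gpar m n j * gpar m n j))
    (aC m n i j * ((ε₁ + ε₂) / 2)) (bC m n i j * ((ε₁ - ε₂) / 2)) (aC m n i j) hα di dj
    (R.X true i 0) (R.X false i 0) (R.X true j 0) (R.X false j 0) (R.H i 0) (R.H i 1)
    (R.H j 0) (R.H j 1) (dd _ _ _ _ _ _ _ _ _ _ _ _) (hd' true).2 (hd' false).2 (hd true).2
    (hd false).2
    (by rw [← r22, tbr, one_smul, Ring.lie_def]) (by rw [dix, ← r23, tbr, one_smul, Ring.lie_def])
    (by rw [← r22j, sbr_eq_tbr]) (by rw [djz, ← r23j, sbr_eq_tbr])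
    (dH _ _ _ _ _ _ _ _ zero_le_one) (dH _ _ _ _ _ _ _ _ le_rfl)
    (dH _ _ _ _ _ _ _ _ zero_le_one) (dH _ _ _ _ _ _ _ _ le_rfl)
    (by rw [H_zero_lie_X R _ _ _ _ zero_le_one]; simp [sgn])
    (by rw [H_zero_lie_X R _ _ _ _ zero_le_one]; simp [sgn])
    (by rw [H_zero_lie_X R _ _ _ _ zero_le_one, hs]; simp [sgn])
    (by rw [H_zero_lie_X R _ _ _ _ zero_le_one, hs]; simp [sgn])
    (lie_H_H R _ _ _ _ le_rfl le_rfl) (lie_H_H R _ _ _ _ le_rfl zero_le_one)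
    (lie_H_H R _ _ _ _ le_rfl zero_le_one) zy xw
    (by rw [dix, djz, Rx]; simp [sgn, acm])
    (by rw [diy, djw, neg_neg, neg_neg, Ry]; simp [sgn, acm, add_comm])
  rw [dix, diy, neg_neg] at key
  have htx : ∀ b, ⁅htld m n ε₁ ε₂ R.H i, R.X b i 1⁆ = aC m n i i • ⁅di, R.X b i 1⁆ := fun b => by
    have hc : ⁅htld m n ε₁ ε₂ R.H i, di⁆ = 0 := by
      simpa using dd i i i j 1 0 0 0 p q r s
    have e := ring_lie_lie (htld m n ε₁ ε₂ R.H i) di (R.X b i 0)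
    rw [hc, ring_zero_lie, zero_add, (hd b).1, htld_lie_X, hi, ring_lie_smul, zero_mul, zero_smul,
      sub_zero, ring_lie_smul, mul_smul] at e
    exact smul_right_injective A (by cases b <;> simp [sgn]) e
  rw [lie_tbr, htx, htx]
  rw [lie_tbr] at key
  rw [← smul_zero (aC m n i i), ← key]
  simp only [tbr, smul_mul_assoc, mul_smul_comm]
  module

/-- The relations among all modes of an even node. -/
theorem even_node_relations (hm : 2 ≤ m) (hn : 2 ≤ n) (R : YtildeRep m n ε₁ ε₂ A)
    (i : ZMod (m + n)) (h0 : i ≠ 0) (hmm : i ≠ (m : ZMod (m + n))) :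
    (∀ r s, ⁅R.H i r, R.H i s⁆ = 0) ∧ (∀ r s, ⁅R.X true i r, R.X false i s⁆ = R.H i (r + s)) ∧
      ∀ b, (∀ r s, exchangeDefect (sgn b * aC m n i i * ((ε₁ + ε₂) / 2)) (R.X b i) r s = 0) ∧
        ∀ r s, cartanDefect (sgn b * aC m n i i * ((ε₁ + ε₂) / 2)) (R.H i) (R.X b i) r s = 0 := by
  have hg := gpar_eq_zero hm hn i h0 hmm
  have hb := bC_self (n := n) hm i
  have hsgn : ∀ b, sgn b ≠ 0 := fun b => by cases b <;> simp [sgn]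
  have hp : (-1 : ℂ) ^ ppar m n i ≠ 0 := pow_ne_zero _ (by norm_num)
  have hp' : (-1 : ℂ) ^ ppar m n i * (-1) ^ ppar m n i = 1 := sgn_ppar_sq m n i
  have haii : aC m n i i = 2 * (-1) ^ ppar m n i := by
    rw [aC_self, ppar_add_one hm hn i h0 hmm]; ring
  have haij : aC m n i (i + 1) = -(-1) ^ ppar m n i := by
    rw [aC_add_one_right hm, ppar_add_one hm hn i h0 hmm]
  have ha : aC m n i i ≠ 0 := by rw [haii]; exact mul_ne_zero two_ne_zero hp
  have hT := htld_lie_tbr R i (i + 1) (add_one_ne_self hm i).symm hg hb (bC_self hm _)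
    (by rw [aC_add_one_left hm hn, aC_add_one_right hm])
    (by rw [haij]; exact neg_ne_zero.mpr hp)
    (by
      have h1 : aC m n i i * aC m n (i + 1) (i + 1) - aC m n i (i + 1) * aC m n i (i + 1)
          = 1 + 2 * ((-1) ^ ppar m n i * (-1) ^ ppar m n (i + 1 + 1)) := by
        rw [haii, haij, aC_self, ppar_add_one hm hn i h0 hmm]
        linear_combination hp'
      rw [h1]
      rcases neg_one_pow_eq_or ℂ (ppar m n i) with h | h <;>
        rcases neg_one_pow_eq_or ℂ (ppar m n (i + 1 + 1)) with h' | h' <;>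
        rw [h, h'] <;> norm_num)
  set t := (aC m n i i)⁻¹ • htld m n ε₁ ε₂ R.H i with ht
  have dX : ∀ b s, ⁅t, R.X b i s⁆ = sgn b • R.X b i (s + 1) := fun b s => by
    rcases s with _ | s
    · rw [ht, ring_smul_lie, htld_lie_X, hb, zero_mul, zero_smul, sub_zero, smul_smul]
      congr 1
      field_simp
    · have := R.recX b i (s + 1) (by omega)
      rw [if_neg (by tauto), ← Ring.lie_def] at this
      rw [this, ht, ring_smul_lie, smul_smul, ← mul_assoc]
      cases b <;> simp [sgn]
  have dx : ∀ s, ⁅t, R.X true i s⁆ = R.X true i (s + 1) := fun s => by rw [dX]; simp [sgn]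
  have dy : ∀ s, ⁅t, R.X false i s⁆ = -R.X false i (s + 1) := fun s => by rw [dX]; simp [sgn]
  have dh : ∀ k ≤ 1, ⁅t, R.H i k⁆ = 0 := fun k hk => by
    rw [ht, ring_smul_lie, htld_lie_H R _ _ _ hk, smul_zero]
  have wX : ∀ b s, ⁅R.H i 0, R.X b i s⁆ = (sgn b * aC m n i i) • R.X b i s := fun b s => by
    induction s with
    | zero => exact H_zero_lie_X R b i i 0 zero_le_one
    | succ s ih =>
      have := congrArg (fun v => ⁅t, v⁆) ih
      simp only [ring_lie_lie t, dh 0 zero_le_one, ring_zero_lie, zero_add, dX, ring_lie_smul,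
        smul_comm _ (sgn b)] at this
      exact smul_right_injective A (hsgn b) this
  have hxy : ∀ r, ⁅R.X true i r, R.X false i 0⁆ = R.H i r := fun r => by
    rcases r with _ | _ | r
    · simpa [hg, sbr_zero_left] using R.rel22 i i
    · simpa [hg, sbr_zero_left] using R.rel23a i i
    · rw [R.recH i (r + 1) (by omega), hg, sbr_zero_left]
  have V1 := lie_modes_eq t (R.X true i) (R.X false i) (R.H i) dx dy hxy 2
    (fun k hk => dh k (by omega)) 1 1 le_rfl
  have dh2 : ⁅t, R.H i 2⁆ = 0 := by
    rw [tbr, one_smul, ← Ring.lie_def, V1] at hT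
    rw [ht, ring_smul_lie, hT, smul_zero]
  have dhk : ∀ k ≤ 2, ⁅t, R.H i k⁆ = 0 := fun k hk => by
    rcases hk.lt_or_eq with hk | rfl
    · exact dh k (by omega)
    · exact dh2
  have R0 : ∀ b, exchangeDefect (sgn b * aC m n i i * ((ε₁ + ε₂) / 2)) (R.X b i) 0 0 = 0 :=
    fun b => by
      have := R.rel26 b i i
      rw [hb, zero_mul, zero_smul, sub_zero] at this
      simp only [hg, sbr_zero_left] at this
      rw [exchangeDefect, this, acm, sub_self]
  have h1 : R.H i 1 = aC m n i i • t + ((ε₁ + ε₂) / 2) • (R.H i 0 * R.H i 0) := by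
    rw [ht, smul_smul, mul_inv_cancel₀ ha, one_smul, htld, sub_add_cancel]
  have wx : ∀ s, ⁅R.H i 0, R.X true i s⁆ = aC m n i i • R.X true i s := fun s => by
    rw [wX]; simp [sgn]
  have wy : ∀ s, ⁅R.H i 0, R.X false i s⁆ = -(aC m n i i • R.X false i s) := fun s => by
    rw [wX]; simp [sgn]
  obtain ⟨RX, RY, D, C⟩ := lie_cartan_eq_zero (aC m n i i) ((ε₁ + ε₂) / 2) ha t (R.X true i)
    (R.X false i) (R.H i) dx dy h1 wx wy hxy dhk (by simpa [sgn] using R0 true)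
    (by simpa [sgn] using R0 false)
  have V : ∀ r s, ⁅R.X true i r, R.X false i s⁆ = R.H i (r + s) := fun r s =>
    lie_modes_eq t _ _ _ dx dy hxy (r + s) (fun k _ => D k) r s le_rfl
  refine ⟨C, V, fun b => ?_⟩
  cases b
  · simp only [sgn, Bool.false_eq_true, if_false, neg_one_mul]
    refine ⟨RY, fun r s => ?_⟩
    exact cartanDefect_eq_zero _ _ (-1) (by norm_num) (-t) (R.X true i 0) _ _
      (fun s => by rw [ring_neg_lie, dy, neg_neg])
      (by rw [h1, neg_smul, smul_neg, neg_neg]) (fun s => by rw [wy, neg_smul]) (r + 1)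
      (by omega) (fun k _ => by rw [ring_neg_lie, D, neg_zero])
      (fun k _ => by rw [ring_lie_skew, V, zero_add, neg_one_smul]) RY r s (by omega)
  · simp only [sgn, if_true, one_mul]
    exact ⟨RX, fun r s => cartanDefect_eq_zero _ _ 1 one_ne_zero t (R.X false i 0) _ _ dx h1 wx
      (r + 1) (by omega) (fun k _ => D k) (fun k _ => by rw [hxy, one_smul]) RX r s (by omega)⟩

end

theorem affine_super_yangian_stmt10
    (m n : ℕ) (hm : 2 ≤ m) (hn : 2 ≤ n) (hmn : m ≠ n) (ε₁ ε₂ : ℂ)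
    (B : Type*) [Ring B] [Algebra ℂ B] (R : YtildeRep m n ε₁ ε₂ B)
    (i : ZMod (m + n)) (h0 : i ≠ 0) (hmm : i ≠ (m : ZMod (m + n))) (r s : ℕ) :
    (R.H i r * R.H i s = R.H i s * R.H i r) ∧
    (sbr (gpar m n i) (gpar m n i) (R.X true i r) (R.X false i s) = R.H i (r + s)) ∧
    (∀ b : Bool,
      sbr (gpar m n i) (gpar m n i) (R.X b i (r + 1)) (R.X b i s)
          - sbr (gpar m n i) (gpar m n i) (R.X b i r) (R.X b i (s + 1))
        = (sgn b * aC m n i i * ((ε₁ + ε₂) / 2)) • acm (R.X b i r) (R.X b i s)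
          - (bC m n i i * ((ε₁ - ε₂) / 2)) •
              sbr (gpar m n i) (gpar m n i) (R.X b i r) (R.X b i s)) ∧
    (∀ b : Bool,
      (R.H i (r + 1) * R.X b i s - R.X b i s * R.H i (r + 1))
          - (R.H i r * R.X b i (s + 1) - R.X b i (s + 1) * R.H i r)
        = (sgn b * aC m n i i * ((ε₁ + ε₂) / 2)) • acm (R.H i r) (R.X b i s)
          - (bC m n i i * ((ε₁ - ε₂) / 2)) •
              (R.H i r * R.X b i s - R.X b i s * R.H i r)) := by
  obtain ⟨C, V, E⟩ := even_node_relations hm hn R i h0 hmm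
  have hb := bC_self (n := n) hm i
  have hg := gpar_eq_zero hm hn i h0 hmm
  simp only [hg, sbr_zero_left, hb, zero_mul, zero_smul, sub_zero, acm, ← Ring.lie_def]
  exact ⟨sub_eq_zero.mp ((Ring.lie_def _ _).symm.trans (C r s)), V r s,
    fun b => sub_eq_zero.mp ((E b).1 r s), fun b => sub_eq_zero.mp ((E b).2 r s)⟩

end
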